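/- For all integers p, q ≥ 1 and signs σ1, σ2 ∈ {1,−1} with (q,σ2) ≠ (1,1), the linear Euler R-sum R_{p,q}^{σ1,σ2}, viewed as a complex number, satisfies R_{p,q}^{σ1,σ2} = 2^{p+q−2} · σ1 · i^{3λ_{σ2}} · ( L_4(q,p; λ_{σ2}, λ_{σ1}) + L_4(q,p; λ_{σ2}, λ_{σ1}+2) − L_4(q,p; λ_{σ2}+2, λ_{σ1}) − L_4(q,p; λ_{σ2}+2, λ_{σ1}+2) ). -/

import Mathlib

open scoped BigOperators

/-- Alternating harmonic number `H_n^{(p)}(σ) = ∑_{k=1}^n σ^{k-1}/k^p`. -/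
noncomputable def harmH (n p : ℕ) (σ : ℝ) : ℝ :=
  ∑ k ∈ Finset.range n, σ ^ k / ((k : ℝ) + 1) ^ p

/-- Linear Euler R-sum `R_{p,q}^{σ1,σ2} = ∑_{n≥1} σ2^{n-1} H_{n-1}^{(p)}(σ1)/(n-1/2)^q`. -/
noncomputable def RSum (p q : ℕ) (σ1 σ2 : ℝ) : ℝ :=
  ∑' n : ℕ, σ2 ^ n * harmH n p σ1 / ((n : ℝ) + 1 / 2) ^ q

/-- Depth-two colored multiple zeta value of level four
`L_4(s1,s2;r1,r2) = ∑_{n1>n2≥1} i^{r1 n1 + r2 n2}/(n1^{s1} n2^{s2})`. -/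
noncomputable def L4 (s1 s2 : ℕ) (r1 r2 : ℕ) : ℂ :=
  ∑' x : {p : ℕ × ℕ // 0 < p.2 ∧ p.2 < p.1},
    Complex.I ^ (r1 * x.1.1 + r2 * x.1.2) / ((x.1.1 : ℂ) ^ s1 * (x.1.2 : ℂ) ^ s2)

/-- `λ_σ = 0` if `σ = 1`, and `λ_σ = 1` if `σ = -1`. -/
noncomputable def lam (σ : ℝ) : ℕ := if σ = 1 then 0 else 1


lemma aux_summable (p q a b : ℕ) (hp : 1 ≤ p) (hq : 2 ≤ q) :
    Summable (fun x : {p : ℕ × ℕ // 0 < p.2 ∧ p.2 < p.1} =>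
      Complex.I ^ (a * x.1.1 + b * x.1.2) / ((x.1.1 : ℂ) ^ q * (x.1.2 : ℂ) ^ p)) := by
  have h1 : Summable (fun n : ℕ => 1 / (n : ℝ) ^ (3 / 2 : ℝ)) :=
    Real.summable_one_div_nat_rpow.2 (by norm_num)
  have h2 := (h1.mul_of_nonneg h1 (fun n => by positivity) (fun n => by positivity))
  have h3 := h2.comp_injective
    (Subtype.val_injective : Function.Injective
      (Subtype.val : {p : ℕ × ℕ // 0 < p.2 ∧ p.2 < p.1} → ℕ × ℕ))
  refine Summable.of_norm_bounded h3 ?_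
  rintro ⟨⟨n, k⟩, hk, hn⟩
  simp only at hk hn
  simp only [Function.comp, norm_div, norm_mul, norm_pow, Complex.norm_I, one_pow,
    Complex.norm_natCast]
  rw [div_mul_div_comm, one_mul]
  have hk1 : (1 : ℝ) ≤ k := by exact_mod_cast hk
  have hkn : (k : ℝ) ≤ n := by exact_mod_cast hn.le
  have hn1 : (1 : ℝ) ≤ n := hk1.trans hkn
  have e : ∀ x : ℝ, 1 ≤ x → x ^ (3 / 2 : ℝ) = x * x ^ (1 / 2 : ℝ) := by
    intro x hx
    rw [show (3 / 2 : ℝ) = 1 + 1 / 2 by norm_num, Real.rpow_add (by linarith), Real.rpow_one]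
  have e2 : (n : ℝ) = (n : ℝ) ^ (1 / 2 : ℝ) * (n : ℝ) ^ (1 / 2 : ℝ) := by
    rw [← Real.rpow_add (by linarith)]; norm_num
  have h4 : (k : ℝ) ^ (1 / 2 : ℝ) ≤ (n : ℝ) ^ (1 / 2 : ℝ) := by gcongr
  have h5 : (n : ℝ) ^ 2 ≤ (n : ℝ) ^ q := pow_le_pow_right₀ hn1 hq
  have h6 : (k : ℝ) ^ 1 ≤ (k : ℝ) ^ p := pow_le_pow_right₀ hk1 hp
  apply one_div_le_one_div_of_le (by positivity)
  calc (n : ℝ) ^ (3 / 2 : ℝ) * (k : ℝ) ^ (3 / 2 : ℝ)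
      = (n * k) * ((n : ℝ) ^ (1 / 2 : ℝ) * (k : ℝ) ^ (1 / 2 : ℝ)) := by
        rw [e _ hn1, e _ hk1]; ring
    _ ≤ (n * k) * ((n : ℝ) ^ (1 / 2 : ℝ) * (n : ℝ) ^ (1 / 2 : ℝ)) := by gcongr
    _ = (n : ℝ) ^ 2 * (k : ℝ) ^ 1 := by rw [← e2]; ring
    _ ≤ _ := by gcongr

lemma aux_nonsummable (c : ℝ) (hc : 0 < c) (d : ℝ) (hd : 0 < d)
    (f : ℕ → ℝ) (hf : ∀ n : ℕ, c / ((n : ℝ) + d) ≤ f n) : ¬ Summable f := by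
  intro h
  obtain ⟨N, hN⟩ := exists_nat_ge d
  have h1 : Summable (fun n : ℕ => c / ((n : ℝ) + d)) :=
    Summable.of_nonneg_of_le (fun n => by positivity) hf h
  have h2 : Summable (fun n : ℕ => c⁻¹ * (c / ((n : ℝ) + d))) := h1.mul_left _
  have h3 : Summable (fun n : ℕ => 1 / (((n + N : ℕ) : ℝ))) := by
    refine Summable.of_nonneg_of_le (fun n => by positivity) (fun n => ?_) h2
    push_cast
    rw [← mul_div_assoc, inv_mul_cancel₀ hc.ne']
    apply one_div_le_one_div_of_le (by positivity)
    linarith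
  exact Real.not_summable_one_div_natCast
    ((summable_nat_add_iff (f := fun n : ℕ => 1 / (n : ℝ)) N).1 h3)

lemma L4_one (p a b : ℕ) : L4 1 p a b = 0 := by
  apply tsum_eq_zero_of_not_summable
  intro h
  let φ : ℕ → {p : ℕ × ℕ // 0 < p.2 ∧ p.2 < p.1} := fun n => ⟨(n + 2, 1), by simp⟩
  have hφ : Function.Injective φ := by
    intro m n hmn
    have := congrArg (fun x => x.1.1) hmn
    simpa [φ] using this
  have h2 := (h.comp_injective hφ).norm
  refine aux_nonsummable 1 one_pos 2 two_pos _ (fun n => ?_) h2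
  have : ‖((n : ℂ) + 2)‖ = (n : ℝ) + 2 := by
    have := Complex.norm_natCast (n + 2)
    push_cast at this
    exact this
  simp [φ, this]

lemma harm_even (p : ℕ) (hp : 1 ≤ p) (σ : ℝ) (h : σ = 1 ∨ σ = -1) (m : ℕ) :
    1 / 2 ≤ harmH (2 * m + 2) p σ := by
  have hσ : -1 ≤ σ := by rcases h with h | h <;> rw [h] <;> norm_num
  have h2 : σ ^ 2 = 1 := by rcases h with h | h <;> rw [h] <;> norm_num
  induction m with
  | zero =>
    have h3 : (2 : ℝ) ^ 1 ≤ 2 ^ p := pow_le_pow_right₀ (by norm_num) hp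
    have h4 : -1 / (2 : ℝ) ^ p ≤ σ / 2 ^ p := by gcongr
    have h5 : 1 / (2 : ℝ) ^ p ≤ 1 / 2 ^ 1 := one_div_le_one_div_of_le (by norm_num) h3
    simp only [harmH, Finset.sum_range_succ, Finset.sum_range_zero]
    norm_num at *
    rw [neg_div] at h4
    norm_num at *
    linarith
  | succ m ih =>
    have e : harmH (2 * (m + 1) + 2) p σ = harmH (2 * m + 2) p σ
        + (1 / ((2 * m + 2 : ℕ) + 1 : ℝ) ^ p + σ / ((2 * m + 3 : ℕ) + 1 : ℝ) ^ p) := by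
      have p1 : σ ^ (2 * m + 2) = 1 := by
        rw [show 2 * m + 2 = 2 * (m + 1) by ring, pow_mul, h2, one_pow]
      have p2 : σ ^ (2 * m + 2 + 1) = σ := by rw [pow_succ, p1, one_mul]
      rw [harmH, show 2 * (m + 1) + 2 = 2 * m + 2 + 1 + 1 by ring, Finset.sum_range_succ,
        Finset.sum_range_succ, harmH, p1, p2, add_assoc]
    rw [e]
    have h4 : -1 / ((2 * m + 3 : ℕ) + 1 : ℝ) ^ p ≤ σ / ((2 * m + 3 : ℕ) + 1 : ℝ) ^ p := by gcongr
    have h5 : 1 / ((2 * m + 3 : ℕ) + 1 : ℝ) ^ p ≤ 1 / ((2 * m + 2 : ℕ) + 1 : ℝ) ^ p := by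
      gcongr; norm_num
    rw [neg_div] at h4
    linarith

lemma RSum_one (p : ℕ) (hp : 1 ≤ p) (σ1 σ2 : ℝ) (h1 : σ1 = 1 ∨ σ1 = -1)
    (h2 : σ2 = 1 ∨ σ2 = -1) : RSum p 1 σ1 σ2 = 0 := by
  apply tsum_eq_zero_of_not_summable
  intro h
  have hφ : Function.Injective (fun m : ℕ => 2 * m + 2) := by
    intro m n hmn
    simpa using hmn
  have h3 := (h.comp_injective hφ).norm
  refine aux_nonsummable (1 / 4) (by norm_num) (5 / 4) (by norm_num) _ (fun m => ?_) h3
  have hσ : |σ2| = 1 := by rcases h2 with h | h <;> rw [h] <;> norm_num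
  have h4 := harm_even p hp σ1 h1 m
  simp only [Function.comp, Real.norm_eq_abs, abs_div, abs_mul, abs_pow, hσ, one_pow, one_mul,
    pow_one]
  have h6 : (0 : ℝ) ≤ ((2 * m + 2 : ℕ) : ℝ) + 1 / 2 := by positivity
  rw [abs_of_nonneg h6, abs_of_nonneg (by linarith)]
  calc (1 / 4 : ℝ) / (m + 5 / 4) = (1 / 2) / (((2 * m + 2 : ℕ) : ℝ) + 1 / 2) := by
        push_cast; field_simp; ring
    _ ≤ _ := by gcongr

lemma main_two (p q : ℕ) (hp : 1 ≤ p) (hq : 2 ≤ q) (σ1 σ2 : ℝ) (a b : ℕ)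
    (h1 : σ1 ^ 2 = 1) (ha : Complex.I ^ (2 * a) = (σ2 : ℂ)) (hb : Complex.I ^ (2 * b) = (σ1 : ℂ)) :
    (RSum p q σ1 σ2 : ℂ) =
      2 ^ (p + q - 2) * (σ1 : ℂ) * Complex.I ^ (3 * a) *
        (L4 q p a b + L4 q p a (b + 2) - L4 q p (a + 2) b - L4 q p (a + 2) (b + 2)) := by
  have s1 := aux_summable p q a b hp hq
  have s2 := aux_summable p q a (b + 2) hp hq
  have s3 := aux_summable p q (a + 2) b hp hq
  have s4 := aux_summable p q (a + 2) (b + 2) hp hq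
  have key := (((s1.hasSum.add s2.hasSum).sub s3.hasSum).sub s4.hasSum).mul_left
    (2 ^ (p + q - 2) * (σ1 : ℂ) * Complex.I ^ (3 * a))
  set G : {p : ℕ × ℕ // 0 < p.2 ∧ p.2 < p.1} → ℂ := fun x =>
    (2 ^ (p + q - 2) * (σ1 : ℂ) * Complex.I ^ (3 * a)) *
    (Complex.I ^ (a * x.1.1 + b * x.1.2) * (1 - (-1) ^ x.1.1) * (1 + (-1) ^ x.1.2) /
      ((x.1.1 : ℂ) ^ q * (x.1.2 : ℂ) ^ p)) with hG
  have key2 : HasSum G (2 ^ (p + q - 2) * (σ1 : ℂ) * Complex.I ^ (3 * a) *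
        (L4 q p a b + L4 q p a (b + 2) - L4 q p (a + 2) b - L4 q p (a + 2) (b + 2))) := by
    refine Eq.mp (congrArg (fun F => HasSum F _) (funext fun x => ?_)) key
    symm
    have i1 : Complex.I ^ (a * x.1.1 + (b + 2) * x.1.2)
        = Complex.I ^ (a * x.1.1 + b * x.1.2) * (-1) ^ x.1.2 := by
      rw [← Complex.I_sq]; ring
    have i2 : Complex.I ^ ((a + 2) * x.1.1 + b * x.1.2)
        = Complex.I ^ (a * x.1.1 + b * x.1.2) * (-1) ^ x.1.1 := by
      rw [← Complex.I_sq]; ring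
    have i3 : Complex.I ^ ((a + 2) * x.1.1 + (b + 2) * x.1.2)
        = Complex.I ^ (a * x.1.1 + b * x.1.2) * (-1) ^ x.1.1 * (-1) ^ x.1.2 := by
      rw [← Complex.I_sq]; ring
    simp only [G, i1, i2, i3]
    ring
  let φ : (Σ n : ℕ, Fin n) → {p : ℕ × ℕ // 0 < p.2 ∧ p.2 < p.1} := fun x =>
    ⟨(2 * x.1 + 1, 2 * (x.2 + 1)), by have := x.2.2; constructor <;> simp only <;> omega⟩
  have hφ : Function.Injective φ := by
    rintro ⟨n, k⟩ ⟨m, l⟩ h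
    have e1 := congrArg (fun x => x.1.1) h
    have e2 := congrArg (fun x => x.1.2) h
    simp only [φ] at e1 e2
    obtain rfl : n = m := by omega
    obtain rfl : k = l := by ext; omega
    rfl
  have hsupp : ∀ x, x ∉ Set.range φ → G x = 0 := by
    rintro ⟨⟨n, k⟩, hk, hn⟩ hx
    simp only at hk hn
    rcases Nat.even_or_odd n with he | ho
    · simp [G, he.neg_one_pow]
    rcases Nat.even_or_odd k with he' | ho'
    · exfalso
      apply hx
      obtain ⟨n', rfl⟩ := ho
      obtain ⟨k', rfl⟩ := he'
      refine ⟨⟨n', ⟨k' - 1, by omega⟩⟩, ?_⟩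
      simp only [φ, Subtype.mk.injEq, Prod.mk.injEq, true_and]
      omega
    · simp [G, ho'.neg_one_pow]
  have key3 := (hφ.hasSum_iff hsupp).2 key2
  have key4 := key3.sigma (fun n => hasSum_fintype _)
  rw [RSum, Complex.ofReal_tsum, ← key4.tsum_eq]
  congr 1
  ext n
  rw [harmH, Finset.sum_range]
  push_cast
  rw [Finset.mul_sum, Finset.sum_div]
  refine Finset.sum_congr rfl fun k _ => ?_
  have e1 : (-1 : ℂ) ^ (2 * n + 1) = -1 := Odd.neg_one_pow ⟨n, rfl⟩
  have e2 : (-1 : ℂ) ^ (2 * ((k : ℕ) + 1)) = 1 := Even.neg_one_pow (even_two_mul _)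
  have e3 : Complex.I ^ (a * (2 * n + 1) + b * (2 * ((k : ℕ) + 1)))
      = (σ2 : ℂ) ^ n * (σ1 : ℂ) ^ (k : ℕ) * σ1 * Complex.I ^ a := by
    rw [← ha, ← hb]; ring
  have e4 : Complex.I ^ (3 * a) * Complex.I ^ a = 1 := by
    rw [← pow_add, show 3 * a + a = 4 * a by ring, pow_mul, Complex.I_pow_four, one_pow]
  have e5 : (2 : ℂ) ^ (p + q - 2) * 4 = 2 ^ p * 2 ^ q := by
    rw [show (4 : ℂ) = 2 ^ 2 by norm_num, ← pow_add, ← pow_add]; congr 1; omega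
  have e6 : (σ1 : ℂ) * σ1 = 1 := by
    rw [← pow_two]; exact_mod_cast h1
  have hn0 : (2 * (n : ℂ) + 1) ≠ 0 := by exact_mod_cast (Nat.succ_ne_zero (2 * n))
  have hk0 : ((k : ℕ) : ℂ) + 1 ≠ 0 := by exact_mod_cast (Nat.succ_ne_zero (k : ℕ))
  have e7 : ((n : ℂ) + 1 / 2) ^ q = (2 * (n : ℂ) + 1) ^ q / 2 ^ q := by
    rw [← div_pow]; congr 1; field_simp
  simp only [Function.comp, G, φ, e1, e2, e3]
  push_cast
  rw [e7, mul_pow]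
  have hn1 := pow_ne_zero q hn0
  have hk1 := pow_ne_zero p hk0
  have : (2 : ℂ) ^ (p + q - 2) * σ1 * Complex.I ^ (3 * a) *
      ((σ2 : ℂ) ^ n * (σ1 : ℂ) ^ (k : ℕ) * σ1 * Complex.I ^ a * (1 - -1) * (1 + 1) /
        ((2 * (n : ℂ) + 1) ^ q * (2 ^ p * ((k : ℕ) + 1 : ℂ) ^ p)))
      = (2 ^ (p + q - 2) * 4) * (σ1 * σ1) * (Complex.I ^ (3 * a) * Complex.I ^ a) *
        ((σ2 : ℂ) ^ n * (σ1 : ℂ) ^ (k : ℕ)) /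
        ((2 * (n : ℂ) + 1) ^ q * (2 ^ p * ((k : ℕ) + 1 : ℂ) ^ p)) := by ring
  rw [this, e4, e5, e6]
  field_simp

theorem stmt12 (p q : ℕ) (hp : 1 ≤ p) (hq : 1 ≤ q) (σ1 σ2 : ℝ)
    (h1 : σ1 = 1 ∨ σ1 = -1) (h2 : σ2 = 1 ∨ σ2 = -1)
    (hne : ¬(q = 1 ∧ σ2 = 1)) :
    (RSum p q σ1 σ2 : ℂ) =
      2 ^ (p + q - 2) * (σ1 : ℂ) * Complex.I ^ (3 * lam σ2) *
        (L4 q p (lam σ2) (lam σ1) + L4 q p (lam σ2) (lam σ1 + 2)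
          - L4 q p (lam σ2 + 2) (lam σ1) - L4 q p (lam σ2 + 2) (lam σ1 + 2)) := by
  have hl : ∀ σ : ℝ, σ = 1 ∨ σ = -1 → Complex.I ^ (2 * lam σ) = (σ : ℂ) := by
    rintro σ (rfl | rfl)
    · simp [lam]
    · have : ¬ ((-1 : ℝ) = 1) := by norm_num
      simp [lam, this]
  rcases Nat.lt_or_ge q 2 with h | h
  · obtain rfl : q = 1 := by omega
    simp [L4_one, RSum_one p hp σ1 σ2 h1 h2]
  · refine main_two p q hp h σ1 σ2 _ _ ?_ (hl _ h2) (hl _ h1)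
    rcases h1 with h | h <;> rw [h] <;> norm_num
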